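/- Let μ be a doubling Radon measure on ℝⁿ (a Borel measure, finite on compact sets, for which there is a constant C_D with 0 < μ(2B) ≤ C_D μ(B) for every ball B), let 1 ≤ p < ∞ and γ ≠ 0, and let f ∈ L¹_loc(ℝⁿ,μ) be nonnegative. For Q ∈ 𝒟 set a(f)_Q = ℓ(Q)^{γ/p} (1/μ(Q)) ∫_Q f dμ (taken to be 0 if μ(Q) = 0), and for (x,t) ∈ ℝⁿ × (0,∞) set a(f)(x,t) = t^{γ/p} (1/μ(B(x,t))) ∫_{B(x,t)} f dμ. Let ν_γ be the measure on ℝⁿ × (0,∞) given by dν_γ = dμ(x) dt / t^{1+γ}. Then there are constants c, C > 0 depending only on n, p, γ, C_D such that c · sup_{λ>0} λᵖ ∑_{Q∈𝒟 : a(f)_Q > λ} ℓ(Q)^{−γ} μ(Q) ≤ sup_{λ>0} λᵖ ν_γ({(x,t) : a(f)(x,t) > λ}) ≤ C · sup_{λ>0} λᵖ ∑_{Q∈𝒟 : a(f)_Q > λ} ℓ(Q)^{−γ} μ(Q). -/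

import Mathlib

open MeasureTheory Set
open scoped ENNReal Classical

noncomputable section

/-- The half-open dyadic cube in `ℝⁿ` of generation `k` (sidelength `2 ^ k`) and
corner index `j`. -/
def dyadicCube (n : ℕ) (k : ℤ) (j : Fin n → ℤ) : Set (Fin n → ℝ) :=
  Set.univ.pi fun i => Set.Ico ((j i : ℝ) * 2 ^ k) (((j i : ℝ) + 1) * 2 ^ k)

/-- The open Euclidean ball of center `x` and radius `t` in `ℝⁿ`. -/
def eBall {n : ℕ} (x : Fin n → ℝ) (t : ℝ) : Set (Fin n → ℝ) :=
  {y | ∑ i, (y i - x i) ^ 2 < t ^ 2}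

/-- The measure `ν_γ` on `ℝⁿ × (0,∞)` given by `dν_γ = dμ(x) dt / t^{1+γ}`
(realized on `ℝⁿ × ℝ`; only sets of points with positive last coordinate are used). -/
def nuGamma {n : ℕ} (μ : Measure (Fin n → ℝ)) (γ : ℝ) : Measure ((Fin n → ℝ) × ℝ) :=
  (μ.prod volume).withDensity fun z => ENNReal.ofReal (z.2 ^ (-(1 + γ)))

section DyadicBall

lemma rpow_le_of_le_mul {l t u : ℝ} (hl : 0 < l) (hu : 1 ≤ u) (h1 : l ≤ t) (h2 : t ≤ u * l)
    (s : ℝ) : t ^ s ≤ u ^ |s| * l ^ s := by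
  have hu0 : 0 < u := one_pos.trans_le hu
  rcases le_total 0 s with hs | hs
  · rw [abs_of_nonneg hs, ← Real.mul_rpow hu0.le hl.le]
    exact Real.rpow_le_rpow (hl.le.trans h1) h2 hs
  · calc t ^ s ≤ l ^ s := Real.rpow_le_rpow_of_nonpos hl h1 hs
      _ ≤ u ^ |s| * l ^ s := le_mul_of_one_le_left (Real.rpow_nonneg hl.le s)
        (Real.one_le_rpow hu (abs_nonneg s))

lemma rpow_le_mul_rpow {l t u : ℝ} (hl : 0 < l) (hu : 1 ≤ u) (h1 : l ≤ t) (h2 : t ≤ u * l)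
    (s : ℝ) : l ^ s ≤ u ^ |s| * t ^ s := by
  have ht : 0 < t := hl.trans_le h1
  have h := rpow_le_of_le_mul hl hu h1 h2 (-s)
  rw [abs_neg, Real.rpow_neg ht.le, Real.rpow_neg hl.le, ← div_eq_mul_inv,
    le_div_iff₀ (Real.rpow_pos_of_pos hl s), inv_mul_eq_div,
    div_le_iff₀ (Real.rpow_pos_of_pos ht s)] at h
  exact h

/-- The center of the dyadic cube of generation `k` and corner index `j`. -/
def dyadicCenter (n : ℕ) (k : ℤ) (j : Fin n → ℤ) : Fin n → ℝ :=
  fun i => ((j i : ℝ) + 1 / 2) * 2 ^ k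

variable {n : ℕ}

lemma mem_dyadicCube {k : ℤ} {j : Fin n → ℤ} {x : Fin n → ℝ} :
    x ∈ dyadicCube n k j ↔ ∀ i, (j i : ℝ) * 2 ^ k ≤ x i ∧ x i < ((j i : ℝ) + 1) * 2 ^ k := by
  simp [dyadicCube]

lemma mem_dyadicCube_iff_floor {k : ℤ} {j : Fin n → ℤ} {x : Fin n → ℝ} :
    x ∈ dyadicCube n k j ↔ ∀ i, ⌊x i / 2 ^ k⌋ = j i := by
  have hl : (0 : ℝ) < 2 ^ k := by positivity
  rw [mem_dyadicCube]
  refine forall_congr' fun i => ?_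
  rw [Int.floor_eq_iff, le_div_iff₀ hl, div_lt_iff₀ hl]

lemma measurableSet_dyadicCube (k : ℤ) (j : Fin n → ℤ) : MeasurableSet (dyadicCube n k j) :=
  MeasurableSet.univ_pi fun _ => measurableSet_Ico

lemma disjoint_dyadicCube {k : ℤ} {j j' : Fin n → ℤ} (h : j ≠ j') :
    Disjoint (dyadicCube n k j) (dyadicCube n k j') := by
  rw [Set.disjoint_left]
  intro x hx hx'
  rw [mem_dyadicCube_iff_floor] at hx hx'
  exact h (funext fun i => (hx i).symm.trans (hx' i))

lemma measurableSet_eBall (x : Fin n → ℝ) (t : ℝ) : MeasurableSet (eBall x t) :=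
  measurableSet_lt (by fun_prop) measurable_const

lemma abs_sub_lt_of_mem_eBall {x y : Fin n → ℝ} {t : ℝ} (ht : 0 < t) (h : y ∈ eBall x t)
    (i : Fin n) : |y i - x i| < t := by
  have h1 : (y i - x i) ^ 2 ≤ ∑ i, (y i - x i) ^ 2 :=
    Finset.single_le_sum (f := fun i => (y i - x i) ^ 2) (fun _ _ => sq_nonneg _)
      (Finset.mem_univ i)
  exact abs_lt_of_sq_lt_sq (h1.trans_lt h) ht.le

lemma mem_eBall_of_abs_sub_le {x y : Fin n → ℝ} {s t : ℝ} (hs : 0 < s)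
    (hst : (n + 1) * s ≤ t) (h : ∀ i, |y i - x i| ≤ s) : y ∈ eBall x t := by
  have h1 : ∑ i, (y i - x i) ^ 2 ≤ n * s ^ 2 := by
    calc ∑ i, (y i - x i) ^ 2 ≤ ∑ _i : Fin n, s ^ 2 :=
          Finset.sum_le_sum fun i _ => sq_le_sq' (abs_le.1 (h i)).1 (abs_le.1 (h i)).2
      _ = n * s ^ 2 := by simp
  have h2 : ((n + 1) * s) ^ 2 ≤ t ^ 2 := pow_le_pow_left₀ (by positivity) hst 2
  have h3 : (n : ℝ) * s ^ 2 < ((n + 1) * s) ^ 2 := by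
    have : 0 < s ^ 2 := by positivity
    have hn : (0 : ℝ) ≤ n := n.cast_nonneg
    nlinarith [mul_nonneg hn this.le, mul_nonneg (mul_nonneg hn hn) this.le]
  exact h1.trans_lt (h3.trans_le h2)

lemma eBall_center_subset_dyadicCube (k : ℤ) (j : Fin n → ℤ) :
    eBall (dyadicCenter n k j) (2 ^ k / 2) ⊆ dyadicCube n k j := by
  intro y hy
  have hl : (0 : ℝ) < 2 ^ k := by positivity
  rw [mem_dyadicCube]
  intro i
  have h := abs_lt.1 (abs_sub_lt_of_mem_eBall (by positivity) hy i)
  simp only [dyadicCenter] at h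
  constructor <;> linarith [h.1, h.2]

lemma abs_sub_center_le {k : ℤ} {j : Fin n → ℤ} {x : Fin n → ℝ} (hx : x ∈ dyadicCube n k j)
    (i : Fin n) : |x i - dyadicCenter n k j i| ≤ 2 ^ k / 2 := by
  have h := mem_dyadicCube.1 hx i
  simp only [dyadicCenter]
  rw [abs_le]
  constructor <;> linarith [h.1, h.2]

lemma abs_sub_le_of_mem_dyadicCube {k : ℤ} {j : Fin n → ℤ} {x y : Fin n → ℝ}
    (hx : x ∈ dyadicCube n k j) (hy : y ∈ dyadicCube n k j) (i : Fin n) :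
    |y i - x i| ≤ 2 ^ k := by
  have h := mem_dyadicCube.1 hx i
  have h' := mem_dyadicCube.1 hy i
  rw [abs_le]
  constructor <;> linarith [h.1, h.2, h'.1, h'.2]

lemma succ_le_two_pow_real (n : ℕ) : (n : ℝ) + 1 ≤ 2 ^ n := by
  exact_mod_cast Nat.succ_le_of_lt n.lt_two_pow_self

lemma dyadicCube_subset_Icc (k : ℤ) (j : Fin n → ℤ) :
    dyadicCube n k j ⊆ Set.Icc (fun i => (j i : ℝ) * 2 ^ k) fun i => ((j i : ℝ) + 1) * 2 ^ k :=
  fun _ hx => ⟨fun i => (mem_dyadicCube.1 hx i).1, fun i => (mem_dyadicCube.1 hx i).2.le⟩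

lemma eBall_subset_Icc (x : Fin n → ℝ) {t : ℝ} (ht : 0 < t) :
    eBall x t ⊆ Set.Icc (fun i => x i - t) fun i => x i + t := by
  refine fun y hy => ⟨fun i => ?_, fun i => ?_⟩ <;>
  · have h := abs_lt.1 (abs_sub_lt_of_mem_eBall ht hy i)
    dsimp only
    linarith [h.1, h.2]

lemma measure_eBall_two_pow_le {μ : Measure (Fin n → ℝ)} {D : ℝ≥0∞}
    (hD : ∀ (x : Fin n → ℝ) (r : ℝ), 0 < r → μ (eBall x (2 * r)) ≤ D * μ (eBall x r))
    (x : Fin n → ℝ) {r : ℝ} (hr : 0 < r) (m : ℕ) :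
    μ (eBall x (2 ^ m * r)) ≤ D ^ m * μ (eBall x r) := by
  induction m with
  | zero => simp
  | succ m ih =>
    calc μ (eBall x (2 ^ (m + 1) * r)) = μ (eBall x (2 * (2 ^ m * r))) := by ring_nf
      _ ≤ D * μ (eBall x (2 ^ m * r)) := hD x _ (by positivity)
      _ ≤ D * (D ^ m * μ (eBall x r)) := by gcongr
      _ = D ^ (m + 1) * μ (eBall x r) := by ring

lemma nuGamma_prod (μ : Measure (Fin n → ℝ)) [SFinite μ] (γ : ℝ)
    {N : Set (Fin n → ℝ)} (I : Set ℝ) :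
    nuGamma μ γ (N ×ˢ I) =
      ∫⁻ z in N ×ˢ I, ENNReal.ofReal (z.2 ^ (-(1 + γ))) ∂(μ.prod volume) :=
  withDensity_apply' _ _

lemma nuGamma_prod_Ico_le (μ : Measure (Fin n → ℝ)) [SFinite μ] (γ : ℝ)
    {N : Set (Fin n → ℝ)} (hN : MeasurableSet N) {l : ℝ} (hl : 0 < l) :
    nuGamma μ γ (N ×ˢ Set.Ico l (2 * l)) ≤
      ENNReal.ofReal (2 ^ |-(1 + γ)|) * (ENNReal.ofReal (l ^ (-γ)) * μ N) := by
  rw [nuGamma_prod]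
  calc _ ≤ ∫⁻ _ in N ×ˢ Set.Ico l (2 * l), ENNReal.ofReal (2 ^ |-(1 + γ)| * l ^ (-(1 + γ)))
          ∂(μ.prod volume) :=
        setLIntegral_mono' (hN.prod measurableSet_Ico) fun z hz => ENNReal.ofReal_le_ofReal
          (rpow_le_of_le_mul hl one_le_two hz.2.1 hz.2.2.le _)
    _ = _ := by
      rw [setLIntegral_const, Measure.prod_prod, Real.volume_Ico,
        ENNReal.ofReal_mul (by positivity), show 2 * l - l = l by ring,
        show l ^ (-γ) = l ^ (-(1 + γ)) * l by
          rw [← Real.rpow_add_one hl.ne']; ring_nf,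
        ENNReal.ofReal_mul (by positivity)]
      ring

lemma le_nuGamma_prod_Ico (μ : Measure (Fin n → ℝ)) [SFinite μ] (γ : ℝ)
    {N : Set (Fin n → ℝ)} (hN : MeasurableSet N) {l u : ℝ} (hl : 0 < l) (hu : 1 ≤ u) :
    ENNReal.ofReal (l ^ (-γ)) * μ N ≤
      ENNReal.ofReal ((2 * u) ^ |-(1 + γ)|) *
        nuGamma μ γ (N ×ˢ Set.Ico (u * l) (2 * u * l)) := by
  have hu0 : 0 < u := one_pos.trans_le hu
  rw [nuGamma_prod, ← lintegral_const_mul _ (by fun_prop)]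
  calc _ ≤ ∫⁻ _ in N ×ˢ Set.Ico (u * l) (2 * u * l), ENNReal.ofReal (l ^ (-(1 + γ)))
          ∂(μ.prod volume) := by
        rw [setLIntegral_const, Measure.prod_prod, Real.volume_Ico,
          show 2 * u * l - u * l = u * l by ring,
          show l ^ (-γ) = l ^ (-(1 + γ)) * l by
            rw [← Real.rpow_add_one hl.ne']; ring_nf,
          ENNReal.ofReal_mul (by positivity), mul_assoc, mul_comm (ENNReal.ofReal l)]
        gcongr
        exact le_mul_of_one_le_left hl.le hu
    _ ≤ _ := by
      refine setLIntegral_mono' (hN.prod measurableSet_Ico) fun z hz => ?_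
      rw [← ENNReal.ofReal_mul (by positivity)]
      refine ENNReal.ofReal_le_ofReal
        (rpow_le_mul_rpow hl (by linarith) ?_ hz.2.2.le _)
      exact (le_mul_of_one_le_left hl.le hu).trans hz.2.1

lemma setAverage_nonneg {α : Type*} [MeasurableSpace α] {μ : Measure α} {f : α → ℝ}
    (hf : ∀ x, 0 ≤ f x) (S : Set α) : 0 ≤ ⨍ x in S, f x ∂μ := by
  rw [setAverage_eq]
  exact smul_nonneg (by positivity) (integral_nonneg hf)

lemma setAverage_le_mul_of_subset {α : Type*} [MeasurableSpace α] {μ : Measure α} {f : α → ℝ}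
    {S T : Set α} {K : ℝ} (hf : ∀ x, 0 ≤ f x) (hK : 0 ≤ K) (hST : S ⊆ T)
    (hfT : IntegrableOn f T μ) (hS : 0 < μ S) (hT : μ T < ∞)
    (h : μ T ≤ ENNReal.ofReal K * μ S) :
    ⨍ x in S, f x ∂μ ≤ K * ⨍ x in T, f x ∂μ := by
  have hS' : μ S < ∞ := (measure_mono hST).trans_lt hT
  have hS0 : 0 < μ.real S := ENNReal.toReal_pos hS.ne' hS'.ne
  have hST' : μ.real S ≤ μ.real T := measureReal_mono hST hT.ne
  have hT0 : 0 < μ.real T := hS0.trans_le hST'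
  have h' : μ.real T ≤ K * μ.real S := by
    have := ENNReal.toReal_mono (ENNReal.mul_ne_top ENNReal.ofReal_ne_top hS'.ne) h
    rwa [ENNReal.toReal_mul, ENNReal.toReal_ofReal hK] at this
  have hI : ∫ x in S, f x ∂μ ≤ ∫ x in T, f x ∂μ :=
    setIntegral_mono_set hfT (Filter.Eventually.of_forall hf) hST.eventuallyLE
  have hI0 : 0 ≤ ∫ x in T, f x ∂μ := integral_nonneg hf
  rw [setAverage_eq, setAverage_eq, smul_eq_mul, smul_eq_mul, inv_mul_eq_div, inv_mul_eq_div,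
    ← mul_div_assoc, div_le_div_iff₀ hS0 hT0]
  calc (∫ x in S, f x ∂μ) * μ.real T ≤ (∫ x in T, f x ∂μ) * (K * μ.real S) := by gcongr
    _ = _ := by ring

lemma setAverage_le_mul_sum_of_subset_biUnion {α ι : Type*} [MeasurableSpace α] {μ : Measure α}
    {f : α → ℝ} {B : Set α} {F : Finset ι} {Q : ι → Set α} {K : ℝ} (hf : ∀ x, 0 ≤ f x)
    (hK : 0 ≤ K) (hB : B ⊆ ⋃ i ∈ F, Q i) (hB0 : 0 < μ B) (hB1 : μ B < ∞)
    (hQ : ∀ i ∈ F, MeasurableSet (Q i)) (hdisj : (F : Set ι).Pairwise (Function.onFun Disjoint Q))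
    (hfQ : ∀ i ∈ F, IntegrableOn f (Q i) μ) (h : ∀ i ∈ F, μ (Q i) ≤ ENNReal.ofReal K * μ B) :
    ⨍ x in B, f x ∂μ ≤ K * ∑ i ∈ F, ⨍ x in Q i, f x ∂μ := by
  have hB0' : 0 < μ.real B := ENNReal.toReal_pos hB0.ne' hB1.ne
  have htop : ENNReal.ofReal K * μ B ≠ ∞ := ENNReal.mul_ne_top ENNReal.ofReal_ne_top hB1.ne
  have hI : ∫ x in B, f x ∂μ ≤ ∑ i ∈ F, ∫ x in Q i, f x ∂μ := by
    rw [← integral_biUnion_finset F hQ hdisj hfQ]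
    exact setIntegral_mono_set (integrableOn_finset_iUnion.2 hfQ) (Filter.Eventually.of_forall hf)
      hB.eventuallyLE
  rw [setAverage_eq, smul_eq_mul, inv_mul_le_iff₀ hB0']
  refine hI.trans ?_
  rw [Finset.mul_sum, Finset.mul_sum]
  refine Finset.sum_le_sum fun i hi => ?_
  have h' : μ.real (Q i) ≤ K * μ.real B := by
    have := ENNReal.toReal_mono htop (h i hi)
    rwa [ENNReal.toReal_mul, ENNReal.toReal_ofReal hK] at this
  have hav : 0 ≤ ⨍ x in Q i, f x ∂μ := setAverage_nonneg hf _
  rw [← measure_smul_setAverage f ((h i hi).trans_lt htop.lt_top).ne, smul_eq_mul]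
  calc _ ≤ K * μ.real B * ⨍ x in Q i, f x ∂μ := by gcongr
    _ = _ := by ring

lemma rpow_mul_le_rpow_mul_iSup {p K : ℝ} (hK : 0 < K) (Φ : ℝ → ℝ≥0∞) {l : ℝ} (hl : 0 < l) :
    ENNReal.ofReal (l ^ p) * Φ (l / K) ≤
      ENNReal.ofReal (K ^ p) * ⨆ l ∈ Set.Ioi (0 : ℝ), ENNReal.ofReal (l ^ p) * Φ l := by
  have h : l ^ p = K ^ p * (l / K) ^ p := by
    rw [← Real.mul_rpow hK.le (by positivity), mul_div_cancel₀ _ hK.ne']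
  rw [h, ENNReal.ofReal_mul (by positivity), mul_assoc]
  gcongr
  exact le_iSup₂ (f := fun l (_ : l ∈ Set.Ioi (0 : ℝ)) => ENNReal.ofReal (l ^ p) * Φ l) (l / K)
    (div_pos hl hK)

lemma iSup_le_mul_iSup_of_le {p K M : ℝ} (hK : 0 < K) (hM : 0 < M) {Φ Ψ : ℝ → ℝ≥0∞}
    (h : ∀ l, 0 < l → Ψ l ≤ ENNReal.ofReal M * Φ (l / K)) :
    (⨆ l ∈ Set.Ioi (0 : ℝ), ENNReal.ofReal (l ^ p) * Ψ l) ≤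
      ENNReal.ofReal (M * K ^ p) * ⨆ l ∈ Set.Ioi (0 : ℝ), ENNReal.ofReal (l ^ p) * Φ l := by
  refine iSup₂_le fun l hl => ?_
  calc ENNReal.ofReal (l ^ p) * Ψ l
      ≤ ENNReal.ofReal (l ^ p) * (ENNReal.ofReal M * Φ (l / K)) := by gcongr; exact h l hl
    _ = ENNReal.ofReal M * (ENNReal.ofReal (l ^ p) * Φ (l / K)) := by ring
    _ ≤ ENNReal.ofReal M * (ENNReal.ofReal (K ^ p) *
          ⨆ l ∈ Set.Ioi (0 : ℝ), ENNReal.ofReal (l ^ p) * Φ l) := by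
        exact mul_le_mul' le_rfl (rpow_mul_le_rpow_mul_iSup hK Φ hl)
    _ = _ := by rw [ENNReal.ofReal_mul hM.le, mul_assoc]

section Doubling

variable {μ : Measure (Fin n → ℝ)} {D : ℝ} {f : (Fin n → ℝ) → ℝ}

lemma measure_le_of_subset_eBall
    (hD : ∀ (x : Fin n → ℝ) (r : ℝ), 0 < r →
      μ (eBall x (2 * r)) ≤ ENNReal.ofReal D * μ (eBall x r)) (hD0 : 0 ≤ D)
    {S T : Set (Fin n → ℝ)} {x : Fin n → ℝ} {r : ℝ} (hr : 0 < r) (m : ℕ)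
    (hS : S ⊆ eBall x (2 ^ m * r)) (hT : eBall x r ⊆ T) :
    μ S ≤ ENNReal.ofReal (D ^ m) * μ T := by
  rw [ENNReal.ofReal_pow hD0]
  calc μ S ≤ μ (eBall x (2 ^ m * r)) := measure_mono hS
    _ ≤ _ := measure_eBall_two_pow_le hD x hr m
    _ ≤ _ := by gcongr

variable [IsFiniteMeasureOnCompacts μ]

lemma measure_eBall_lt_top (x : Fin n → ℝ) {t : ℝ} (ht : 0 < t) : μ (eBall x t) < ∞ :=
  (measure_mono (eBall_subset_Icc x ht)).trans_lt isCompact_Icc.measure_lt_top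

/-- The average over a dyadic cube is controlled by averages over comparable larger balls. -/
lemma average_dyadicCube_le_average_eBall
    (hD : ∀ (x : Fin n → ℝ) (r : ℝ), 0 < r →
      μ (eBall x (2 * r)) ≤ ENNReal.ofReal D * μ (eBall x r)) (hD0 : 0 ≤ D)
    (hpos : ∀ (x : Fin n → ℝ) (r : ℝ), 0 < r → 0 < μ (eBall x r))
    (hf : ∀ x, 0 ≤ f x) (hfi : LocallyIntegrable f μ) {k : ℤ} {j : Fin n → ℤ}
    {x : Fin n → ℝ} (hx : x ∈ dyadicCube n k j) {t : ℝ}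
    (ht : t ∈ Set.Ico ((2 : ℝ) ^ n * 2 ^ k) (2 * 2 ^ n * 2 ^ k)) :
    ⨍ y in dyadicCube n k j, f y ∂μ ≤ D ^ (2 * n + 3) * ⨍ y in eBall x t, f y ∂μ := by
  have hl : (0 : ℝ) < 2 ^ k := by positivity
  have hn := succ_le_two_pow_real n
  have h1 : (1 : ℝ) ≤ 2 ^ n := one_le_pow₀ one_le_two
  have hnl : (2 : ℝ) ^ k ≤ 2 ^ n * 2 ^ k := le_mul_of_one_le_left hl.le h1
  have ht0 : 0 < t := lt_of_lt_of_le (by positivity) ht.1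
  refine setAverage_le_mul_of_subset hf (by positivity) ?_ ?_ ?_ (measure_eBall_lt_top x ht0) ?_
  · exact fun y hy => mem_eBall_of_abs_sub_le hl ((mul_le_mul_of_nonneg_right hn hl.le).trans ht.1)
      (abs_sub_le_of_mem_dyadicCube hx hy)
  · exact (hfi.integrableOn_isCompact isCompact_Icc).mono_set (eBall_subset_Icc x ht0)
  · exact (hpos _ _ (by positivity)).trans_le
      (measure_mono (eBall_center_subset_dyadicCube k j))
  · refine measure_le_of_subset_eBall hD hD0 (by positivity) (2 * n + 3) (fun y hy => ?_)
      (eBall_center_subset_dyadicCube k j)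
    refine mem_eBall_of_abs_sub_le (s := 4 * (2 ^ n * 2 ^ k)) (by positivity) ?_ fun i => ?_
    · calc ((n : ℝ) + 1) * (4 * (2 ^ n * 2 ^ k)) ≤ 2 ^ n * (4 * (2 ^ n * 2 ^ k)) := by gcongr
        _ = 2 ^ (2 * n + 3) * (2 ^ k / 2) := by ring
    · have h2 := abs_lt.1 (abs_sub_lt_of_mem_eBall ht0 hy i)
      have h3 := abs_le.1 (abs_sub_center_le hx i)
      have h4 := ht.2
      rw [abs_le]
      constructor <;> linarith [h2.1, h2.2, h3.1, h3.2]

/-- A large average over a ball of radius comparable to `2 ^ k` forces a large average over a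
nearby dyadic cube of generation `k`. -/
lemma exists_dyadicCube_average_lt
    (hD : ∀ (x : Fin n → ℝ) (r : ℝ), 0 < r →
      μ (eBall x (2 * r)) ≤ ENNReal.ofReal D * μ (eBall x r)) (hD0 : 0 ≤ D)
    (hpos : ∀ (x : Fin n → ℝ) (r : ℝ), 0 < r → 0 < μ (eBall x r))
    (hf : ∀ x, 0 ≤ f x) (hfi : LocallyIntegrable f μ) {k : ℤ} {x : Fin n → ℝ} {t b : ℝ}
    (ht : t ∈ Set.Ico ((2 : ℝ) ^ k) (2 * 2 ^ k))
    (hb : D ^ (n + 2) * 5 ^ n * b < ⨍ y in eBall x t, f y ∂μ) :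
    ∃ j : Fin n → ℤ, b < ⨍ y in dyadicCube n k j, f y ∂μ ∧
      x ∈ eBall (dyadicCenter n k j) (2 ^ (n + 3) * (2 ^ k / 2)) := by
  have hl : (0 : ℝ) < 2 ^ k := by positivity
  have hn := succ_le_two_pow_real n
  have ht0 : 0 < t := hl.trans_le ht.1
  let F : Finset (Fin n → ℤ) := Fintype.piFinset fun i =>
    Finset.Icc (⌊x i / 2 ^ k⌋ - 2) (⌊x i / 2 ^ k⌋ + 2)
  have hcard : F.card = 5 ^ n := by
    simp only [F, Fintype.card_piFinset, Int.card_Icc]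
    rw [Finset.prod_congr rfl (g := fun _ => 5) fun i _ => by
      rw [show ⌊x i / 2 ^ k⌋ + 2 + 1 - (⌊x i / 2 ^ k⌋ - 2) = 5 by ring]; rfl]
    simp
  have hfloor : ∀ i, (⌊x i / 2 ^ k⌋ : ℝ) * 2 ^ k ≤ x i ∧ x i < (⌊x i / 2 ^ k⌋ + 1) * 2 ^ k :=
    fun i => ⟨(le_div_iff₀ hl).1 (Int.floor_le _), (div_lt_iff₀ hl).1 (Int.lt_floor_add_one _)⟩
  have hbound : ∀ j ∈ F, ∀ i, ((⌊x i / 2 ^ k⌋ : ℝ) - 2) * 2 ^ k ≤ j i * 2 ^ k ∧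
      (j i : ℝ) * 2 ^ k ≤ (⌊x i / 2 ^ k⌋ + 2) * 2 ^ k := by
    intro j hj i
    have h := Finset.mem_Icc.1 (Fintype.mem_piFinset.1 hj i)
    constructor <;> refine mul_le_mul_of_nonneg_right ?_ hl.le
    · exact_mod_cast h.1
    · exact_mod_cast h.2
  have hcover : eBall x t ⊆ ⋃ j ∈ F, dyadicCube n k j := by
    intro y hy
    refine Set.mem_biUnion (x := fun i => ⌊y i / 2 ^ k⌋) (Fintype.mem_piFinset.2 fun i => ?_)
      (mem_dyadicCube_iff_floor.2 fun _ => rfl)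
    have h2 := abs_lt.1 (abs_sub_lt_of_mem_eBall ht0 hy i)
    have h3 := ht.2
    rw [Finset.mem_Icc]
    constructor
    · rw [Int.le_floor, le_div_iff₀ hl]
      push_cast
      linarith [(hfloor i).1, h2.1]
    · rw [← Int.lt_add_one_iff, Int.floor_lt, div_lt_iff₀ hl]
      push_cast
      linarith [(hfloor i).2, h2.2]
  have hmeas : ∀ j ∈ F, μ (dyadicCube n k j) ≤ ENNReal.ofReal (D ^ (n + 2)) * μ (eBall x t) := by
    refine fun j hj => measure_le_of_subset_eBall hD hD0 ht0 (n + 2) (fun y hy => ?_) subset_rfl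
    refine mem_eBall_of_abs_sub_le (s := 4 * 2 ^ k) (by positivity) ?_ fun i => ?_
    · calc ((n : ℝ) + 1) * (4 * 2 ^ k) ≤ 2 ^ n * (4 * t) := by gcongr; exact ht.1
        _ = 2 ^ (n + 2) * t := by ring
    · have h2 := mem_dyadicCube.1 hy i
      rw [abs_le]
      constructor <;> linarith [hfloor i, hbound j hj i, h2.1, h2.2]
  have havg := setAverage_le_mul_sum_of_subset_biUnion (f := f) hf (by positivity) hcover
    (hpos x t ht0) (measure_eBall_lt_top x ht0) (fun j _ => measurableSet_dyadicCube k j)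
    (fun j _ j' _ h => disjoint_dyadicCube h)
    (fun j _ => (hfi.integrableOn_isCompact isCompact_Icc).mono_set (dyadicCube_subset_Icc k j))
    hmeas
  obtain ⟨j, hjF, hj⟩ : ∃ j ∈ F, b < ⨍ y in dyadicCube n k j, f y ∂μ := by
    by_contra! hcon
    have hsum := Finset.sum_le_card_nsmul F _ b hcon
    rw [hcard, nsmul_eq_mul] at hsum
    push_cast at hsum
    have := mul_le_mul_of_nonneg_left hsum (pow_nonneg hD0 (n + 2))
    linarith
  refine ⟨j, hj, mem_eBall_of_abs_sub_le (s := 4 * 2 ^ k) (by positivity) ?_ fun i => ?_⟩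
  · calc ((n : ℝ) + 1) * (4 * 2 ^ k) ≤ 2 ^ n * (4 * 2 ^ k) := by gcongr
      _ = 2 ^ (n + 3) * (2 ^ k / 2) := by ring
  · simp only [dyadicCenter]
    rw [abs_le]
    constructor <;> linarith [hfloor i, hbound j hjF i]

lemma nuGamma_superlevel_le [SFinite μ]
    (hD : ∀ (x : Fin n → ℝ) (r : ℝ), 0 < r →
      μ (eBall x (2 * r)) ≤ ENNReal.ofReal D * μ (eBall x r)) (hD0 : 0 < D)
    (hpos : ∀ (x : Fin n → ℝ) (r : ℝ), 0 < r → 0 < μ (eBall x r))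
    (hf : ∀ x, 0 ≤ f x) (hfi : LocallyIntegrable f μ) (s γ : ℝ) {l : ℝ} (hl : 0 < l) :
    nuGamma μ γ {z : (Fin n → ℝ) × ℝ | 0 < z.2 ∧ l < z.2 ^ s * ⨍ y in eBall z.1 z.2, f y ∂μ} ≤
      ENNReal.ofReal (2 ^ |-(1 + γ)| * D ^ (n + 3)) * ∑' Q : ℤ × (Fin n → ℤ),
        if l / (D ^ (n + 2) * 5 ^ n * 2 ^ |s|) <
            ((2 : ℝ) ^ Q.1) ^ s * ⨍ x in dyadicCube n Q.1 Q.2, f x ∂μ then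
          ENNReal.ofReal (((2 : ℝ) ^ Q.1) ^ (-γ)) * μ (dyadicCube n Q.1 Q.2) else 0 := by
  set K : ℝ := D ^ (n + 2) * 5 ^ n * 2 ^ |s| with hK
  let R : ℤ × (Fin n → ℤ) → Set ((Fin n → ℝ) × ℝ) := fun Q =>
    if l / K < ((2 : ℝ) ^ Q.1) ^ s * ⨍ x in dyadicCube n Q.1 Q.2, f x ∂μ then
      eBall (dyadicCenter n Q.1 Q.2) (2 ^ (n + 3) * (2 ^ Q.1 / 2)) ×ˢ
        Set.Ico ((2 : ℝ) ^ Q.1) (2 * 2 ^ Q.1) else ∅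
  have hcover : {z : (Fin n → ℝ) × ℝ | 0 < z.2 ∧ l < z.2 ^ s * ⨍ y in eBall z.1 z.2, f y ∂μ} ⊆
      ⋃ Q, R Q := by
    rintro ⟨x, t⟩ ⟨ht0, hlt⟩
    dsimp only at ht0 hlt
    obtain ⟨k, hk⟩ := exists_mem_Ico_zpow ht0 one_lt_two
    rw [zpow_add_one₀ two_ne_zero, mul_comm] at hk
    have hk0 : (0 : ℝ) < 2 ^ k := by positivity
    have hks : (0 : ℝ) < ((2 : ℝ) ^ k) ^ s := by positivity
    have hav : 0 ≤ ⨍ y in eBall x t, f y ∂μ := setAverage_nonneg hf _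
    have hlt' : l < 2 ^ |s| * ((2 : ℝ) ^ k) ^ s * ⨍ y in eBall x t, f y ∂μ :=
      hlt.trans_le (mul_le_mul_of_nonneg_right
        (rpow_le_of_le_mul hk0 one_le_two hk.1 hk.2.le s) hav)
    obtain ⟨j, hj, hxj⟩ := exists_dyadicCube_average_lt (b := l / K / ((2 : ℝ) ^ k) ^ s)
      hD hD0.le hpos hf hfi hk (by
        have : D ^ (n + 2) * 5 ^ n * (l / K / ((2 : ℝ) ^ k) ^ s) =
            l / (2 ^ |s| * ((2 : ℝ) ^ k) ^ s) := by
          rw [hK]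
          field_simp
        rwa [this, div_lt_iff₀' (by positivity)])
    rw [div_lt_iff₀' hks] at hj
    refine Set.mem_iUnion.2 ⟨(k, j), ?_⟩
    simp only [R, if_pos hj]
    exact ⟨hxj, hk⟩
  refine (measure_mono hcover).trans ((measure_iUnion_le R).trans ?_)
  rw [← ENNReal.tsum_mul_left]
  refine ENNReal.tsum_le_tsum fun Q => ?_
  by_cases hQ : l / K < ((2 : ℝ) ^ Q.1) ^ s * ⨍ x in dyadicCube n Q.1 Q.2, f x ∂μ
  · simp only [R, if_pos hQ]
    have h1 : μ (eBall (dyadicCenter n Q.1 Q.2) (2 ^ (n + 3) * (2 ^ Q.1 / 2))) ≤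
        ENNReal.ofReal (D ^ (n + 3)) * μ (dyadicCube n Q.1 Q.2) :=
      measure_le_of_subset_eBall hD hD0.le (by positivity) (n + 3) subset_rfl
        (eBall_center_subset_dyadicCube Q.1 Q.2)
    refine (nuGamma_prod_Ico_le μ γ (measurableSet_eBall _ _) (by positivity)).trans ?_
    calc _ ≤ ENNReal.ofReal (2 ^ |-(1 + γ)|) * (ENNReal.ofReal (((2 : ℝ) ^ Q.1) ^ (-γ)) *
          (ENNReal.ofReal (D ^ (n + 3)) * μ (dyadicCube n Q.1 Q.2))) :=
          mul_le_mul' le_rfl (mul_le_mul' le_rfl h1)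
      _ = _ := by rw [ENNReal.ofReal_mul (by positivity)]; ring
  · simp [R, hQ]

lemma pairwise_disjoint_dyadicCube_prod_Ico (n m : ℕ) :
    Pairwise (Function.onFun Disjoint fun Q : ℤ × (Fin n → ℤ) =>
      dyadicCube n Q.1 Q.2 ×ˢ Set.Ico ((2 : ℝ) ^ m * 2 ^ Q.1) (2 * 2 ^ m * 2 ^ Q.1)) := by
  rintro ⟨k, j⟩ ⟨k', j'⟩ h
  rw [Function.onFun, Set.disjoint_prod]
  by_cases hk : k = k'
  · subst hk
    exact Or.inl (disjoint_dyadicCube fun hj => h (Prod.ext rfl hj))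
  · right
    have hI : ∀ k : ℤ, Set.Ico ((2 : ℝ) ^ m * 2 ^ k) (2 * 2 ^ m * 2 ^ k) =
        Set.Ico ((2 : ℝ) ^ (m + k)) (2 ^ (m + k + 1)) := by
      intro k
      rw [zpow_add_one₀ two_ne_zero, zpow_add₀ two_ne_zero, zpow_natCast]
      ring_nf
    dsimp only
    rw [hI, hI]
    have hmono : Monotone fun k : ℤ => (2 : ℝ) ^ k := zpow_right_mono₀ one_le_two
    exact hmono.pairwise_disjoint_on_Ico_succ (fun h => hk (by simpa using h))

lemma tsum_dyadicCube_superlevel_le [SFinite μ]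
    (hD : ∀ (x : Fin n → ℝ) (r : ℝ), 0 < r →
      μ (eBall x (2 * r)) ≤ ENNReal.ofReal D * μ (eBall x r)) (hD0 : 0 < D)
    (hpos : ∀ (x : Fin n → ℝ) (r : ℝ), 0 < r → 0 < μ (eBall x r))
    (hf : ∀ x, 0 ≤ f x) (hfi : LocallyIntegrable f μ) (s γ l : ℝ) :
    (∑' Q : ℤ × (Fin n → ℤ),
        if l < ((2 : ℝ) ^ Q.1) ^ s * ⨍ x in dyadicCube n Q.1 Q.2, f x ∂μ then
          ENNReal.ofReal (((2 : ℝ) ^ Q.1) ^ (-γ)) * μ (dyadicCube n Q.1 Q.2) else 0) ≤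
      ENNReal.ofReal ((2 * 2 ^ n) ^ |-(1 + γ)|) *
        nuGamma μ γ {z : (Fin n → ℝ) × ℝ | 0 < z.2 ∧
          l / (D ^ (2 * n + 3) * (2 * 2 ^ n) ^ |s|) <
            z.2 ^ s * ⨍ y in eBall z.1 z.2, f y ∂μ} := by
  let R : ℤ × (Fin n → ℤ) → Set ((Fin n → ℝ) × ℝ) := fun Q =>
    dyadicCube n Q.1 Q.2 ×ˢ Set.Ico ((2 : ℝ) ^ n * 2 ^ Q.1) (2 * 2 ^ n * 2 ^ Q.1)
  let P : Set (ℤ × (Fin n → ℤ)) :=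
    {Q | l < ((2 : ℝ) ^ Q.1) ^ s * ⨍ x in dyadicCube n Q.1 Q.2, f x ∂μ}
  have h1n : (1 : ℝ) ≤ 2 ^ n := one_le_pow₀ one_le_two
  have hsub : ⋃ Q ∈ P, R Q ⊆ {z : (Fin n → ℝ) × ℝ | 0 < z.2 ∧
      l / (D ^ (2 * n + 3) * (2 * 2 ^ n) ^ |s|) < z.2 ^ s * ⨍ y in eBall z.1 z.2, f y ∂μ} := by
    refine Set.iUnion₂_subset ?_
    rintro ⟨k, j⟩ hQ ⟨x, t⟩ ⟨hx, ht⟩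
    dsimp only at hx ht
    have hk0 : (0 : ℝ) < 2 ^ k := by positivity
    have hkt : (2 : ℝ) ^ k ≤ t := (le_mul_of_one_le_left hk0.le h1n).trans ht.1
    have h1 := average_dyadicCube_le_average_eBall hD hD0.le hpos hf hfi hx ht
    have h2 := rpow_le_mul_rpow hk0 (u := 2 * 2 ^ n) (by linarith) hkt ht.2.le s
    refine ⟨hk0.trans_le hkt, ?_⟩
    rw [div_lt_iff₀' (by positivity)]
    calc l < ((2 : ℝ) ^ k) ^ s * ⨍ x in dyadicCube n k j, f x ∂μ := hQ
      _ ≤ ((2 * 2 ^ n) ^ |s| * t ^ s) * (D ^ (2 * n + 3) * ⨍ y in eBall x t, f y ∂μ) := by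
        have ht0 : 0 ≤ t := hk0.le.trans hkt
        exact mul_le_mul h2 h1 (setAverage_nonneg hf _) (by positivity)
      _ = _ := by ring
  calc _ ≤ ∑' Q, P.indicator (fun Q => ENNReal.ofReal ((2 * 2 ^ n) ^ |-(1 + γ)|) *
          nuGamma μ γ (R Q)) Q := by
        refine ENNReal.tsum_le_tsum fun Q => ?_
        rw [Set.indicator_apply]
        simp only [P, Set.mem_ofPred_eq]
        split_ifs
        · exact le_nuGamma_prod_Ico μ γ (measurableSet_dyadicCube _ _) (by positivity) h1n
        · exact le_rfl
    _ = ENNReal.ofReal ((2 * 2 ^ n) ^ |-(1 + γ)|) * nuGamma μ γ (⋃ Q ∈ P, R Q) := by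
        rw [← tsum_subtype, ENNReal.tsum_mul_left, measure_biUnion P.to_countable
          (fun Q _ Q' _ h => pairwise_disjoint_dyadicCube_prod_Ico n n h)
          fun Q _ => (measurableSet_dyadicCube _ _).prod measurableSet_Ico]
    _ ≤ _ := mul_le_mul' le_rfl (measure_mono hsub)

end Doubling

end DyadicBall

/-- for a doubling Radon measure `μ`, `1 ≤ p < ∞`, `γ ≠ 0` and a
nonnegative `f ∈ L¹_loc(μ)`, the dyadic weak-type quantity built from the means
`a(f)_Q = ℓ(Q)^{γ/p} ⨍_Q f dμ` is comparable to the continuous weak-type quantity built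
from `a(f)(x,t) = t^{γ/p} ⨍_{B(x,t)} f dμ` and `ν_γ`. -/
theorem statement15 (n : ℕ) (p γ C_D : ℝ) (hp : 1 ≤ p) (hγ : γ ≠ 0) :
    ∃ c C : ℝ, 0 < c ∧ 0 < C ∧
      ∀ (μ : Measure (Fin n → ℝ)), IsFiniteMeasureOnCompacts μ →
      (∀ (x : Fin n → ℝ) (r : ℝ), 0 < r →
        0 < μ (eBall x (2 * r)) ∧ μ (eBall x (2 * r)) ≤ ENNReal.ofReal C_D * μ (eBall x r)) →
      ∀ f : (Fin n → ℝ) → ℝ, (∀ x, 0 ≤ f x) → LocallyIntegrable f μ →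
      (ENNReal.ofReal c *
          ⨆ l ∈ Set.Ioi (0 : ℝ), ENNReal.ofReal (l ^ p) *
            ∑' Q : ℤ × (Fin n → ℤ),
              if l < ((2 : ℝ) ^ Q.1) ^ (γ / p) * ⨍ x in dyadicCube n Q.1 Q.2, f x ∂μ then
                ENNReal.ofReal (((2 : ℝ) ^ Q.1) ^ (-γ)) * μ (dyadicCube n Q.1 Q.2) else 0)
        ≤ (⨆ l ∈ Set.Ioi (0 : ℝ), ENNReal.ofReal (l ^ p) *
            nuGamma μ γ {z : (Fin n → ℝ) × ℝ |
              0 < z.2 ∧ l < z.2 ^ (γ / p) * ⨍ y in eBall z.1 z.2, f y ∂μ}) ∧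
      (⨆ l ∈ Set.Ioi (0 : ℝ), ENNReal.ofReal (l ^ p) *
            nuGamma μ γ {z : (Fin n → ℝ) × ℝ |
              0 < z.2 ∧ l < z.2 ^ (γ / p) * ⨍ y in eBall z.1 z.2, f y ∂μ})
        ≤ ENNReal.ofReal C *
          ⨆ l ∈ Set.Ioi (0 : ℝ), ENNReal.ofReal (l ^ p) *
            ∑' Q : ℤ × (Fin n → ℤ),
              if l < ((2 : ℝ) ^ Q.1) ^ (γ / p) * ⨍ x in dyadicCube n Q.1 Q.2, f x ∂μ then
                ENNReal.ofReal (((2 : ℝ) ^ Q.1) ^ (-γ)) * μ (dyadicCube n Q.1 Q.2) else 0 := by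
  set D : ℝ := max C_D 1
  have hD0 : 0 < D := one_pos.trans_le (le_max_right _ _)
  have hK₁ : (0 : ℝ) < D ^ (2 * n + 3) * (2 * 2 ^ n) ^ |γ / p| := by positivity
  have hK₂ : (0 : ℝ) < D ^ (n + 2) * 5 ^ n * 2 ^ |γ / p| := by positivity
  have hM₁ : (0 : ℝ) < (2 * 2 ^ n) ^ |-(1 + γ)| := by positivity
  have hM₂ : (0 : ℝ) < 2 ^ |-(1 + γ)| * D ^ (n + 3) := by positivity
  refine ⟨((2 * 2 ^ n) ^ |-(1 + γ)| * (D ^ (2 * n + 3) * (2 * 2 ^ n) ^ |γ / p|) ^ p)⁻¹,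
    2 ^ |-(1 + γ)| * D ^ (n + 3) * (D ^ (n + 2) * 5 ^ n * 2 ^ |γ / p|) ^ p,
    by positivity, by positivity, fun μ hμ hdbl f hf hfi => ?_⟩
  have : IsLocallyFiniteMeasure μ := isLocallyFiniteMeasure_of_isFiniteMeasureOnCompacts
  have hD : ∀ (x : Fin n → ℝ) (r : ℝ), 0 < r →
      μ (eBall x (2 * r)) ≤ ENNReal.ofReal D * μ (eBall x r) := fun x r hr =>
    (hdbl x r hr).2.trans (mul_le_mul' (ENNReal.ofReal_le_ofReal (le_max_left _ _)) le_rfl)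
  have hpos : ∀ (x : Fin n → ℝ) (r : ℝ), 0 < r → 0 < μ (eBall x r) := fun x r hr => by
    simpa [mul_div_cancel₀] using (hdbl x (r / 2) (half_pos hr)).1
  constructor
  · rw [ENNReal.ofReal_inv_of_pos (by positivity), mul_comm, ← div_eq_mul_inv]
    refine ENNReal.div_le_of_le_mul' ?_
    exact iSup_le_mul_iSup_of_le hK₁ hM₁
      (Φ := fun l => nuGamma μ γ {z : (Fin n → ℝ) × ℝ |
        0 < z.2 ∧ l < z.2 ^ (γ / p) * ⨍ y in eBall z.1 z.2, f y ∂μ})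
      fun l _ => tsum_dyadicCube_superlevel_le hD hD0 hpos hf hfi (γ / p) γ l
  · exact iSup_le_mul_iSup_of_le hK₂ hM₂
      (Φ := fun l => ∑' Q : ℤ × (Fin n → ℤ),
        if l < ((2 : ℝ) ^ Q.1) ^ (γ / p) * ⨍ x in dyadicCube n Q.1 Q.2, f x ∂μ then
          ENNReal.ofReal (((2 : ℝ) ^ Q.1) ^ (-γ)) * μ (dyadicCube n Q.1 Q.2) else 0)
      fun l hl => nuGamma_superlevel_le hD hD0 hpos hf hfi (γ / p) γ hl
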